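/- There exists a positive constant M_1 such that for every n and every subset S of B_n × B_n, ν^T_n(S) ≤ M_1·ν^P_n(S) + O(n^{-1}), where the implied constant in the O-term is absolute (independent of S). -/

import Mathlib

open scoped Classical

inductive PTree : Type
  | leaf : PTree
  | node : PTree → PTree → PTree
deriving DecidableEq

namespace PTree

def size : PTree → ℕ
  | leaf => 1
  | node l r => size l + size r

def cherries : PTree → ℕ
  | leaf => 0
  | node leaf leaf => 1
  | node l r => cherries l + cherries r

def height : PTree → ℕ
  | leaf => 0
  | node l r => max (height l) (height r) + 1

def encode : PTree → ℕ
  | leaf => 0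
  | node l r => Nat.pair (encode l) (encode r) + 1

def normalize : PTree → PTree
  | leaf => leaf
  | node l r =>
      let l' := normalize l
      let r' := normalize r
      if encode l' ≤ encode r' then node l' r' else node r' l'

def isoFuns : PTree → PTree → List (ℕ → ℕ)
  | leaf, leaf => [fun i => i]
  | node l r, node l' r' =>
      ((isoFuns l l').flatMap fun g => (isoFuns r r').map fun h =>
        fun i => if i < l.size then g i else h (i - l.size) + l'.size)
      ++
      ((isoFuns l r').flatMap fun g => (isoFuns r l').map fun h =>
        fun i => if i < l.size then g i + l'.size else h (i - l.size))
  | _, _ => []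

def planeTrees : ℕ → Finset PTree
  | 0 => ∅
  | 1 => {leaf}
  | n + 2 =>
      (Finset.range (n + 1)).attach.biUnion fun k =>
        ((planeTrees (k.1 + 1)) ×ˢ (planeTrees (n + 1 - k.1))).image
          fun p => node p.1 p.2
  termination_by n => n
  decreasing_by
  · have := Finset.mem_range.mp k.2; omega
  · omega

def binTrees (n : ℕ) : Finset PTree := (planeTrees n).image normalize

/-- Triples (T, v, S): left plane tree, right plane tree, and a matching `v`
(a permutation of `0, …, n-1`, encoded as the list of its values) matching
leaf `i` of `T` with leaf `v i` of `S`. -/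
def Triples (n : ℕ) : Finset (PTree × PTree × List ℕ) :=
  (planeTrees n) ×ˢ ((planeTrees n) ×ˢ (List.range n).permutations.toFinset)

/-- Two triples represent the same tanglegram iff there are isomorphisms of the left
trees and of the right trees compatible with the matchings. -/
def equivTriple (n : ℕ) (t t' : PTree × PTree × List ℕ) : Bool :=
  (isoFuns t.1 t'.1).any fun φ => (isoFuns t.2.1 t'.2.1).any fun ψ =>
    (List.range n).all fun i => t'.2.2.getD (φ i) 0 == ψ (t.2.2.getD i 0)

/-- The tanglegrams of size `n`: equivalence classes of triples. -/
def tangleClasses (n : ℕ) : Finset (Finset (PTree × PTree × List ℕ)) :=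
  (Triples n).image fun t => (Triples n).filter (fun t' => equivTriple n t t' = true)

/-- The number of tanglegrams of size `n`. -/
def numTanglegrams (n : ℕ) : ℕ := (tangleClasses n).card

/-- The probability that a uniformly random tanglegram of size `n` satisfies the
(isomorphism-invariant) property `P` of triples. -/
noncomputable def tangleProb (n : ℕ) (P : PTree × PTree × List ℕ → Prop) : ℝ :=
  ((tangleClasses n).filter fun c => ∃ t ∈ c, P t).card / numTanglegrams n

/-- The expectation of the statistic `f` of a uniformly random tanglegram of size `n`. -/
noncomputable def tangleExp (n : ℕ) (f : PTree × PTree × List ℕ → ℕ) : ℝ :=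
  ∑' k : ℕ, (k : ℝ) * tangleProb n (fun t => f t = k)

end PTree

namespace PTree

/-- The distribution on pairs of binary trees (canonical representatives) induced by
the two halves of a uniformly random tanglegram of size `n`:
probability that the pair of isomorphism classes of the two trees lies in `S`. -/
noncomputable def nuT (n : ℕ) (S : Finset (PTree × PTree)) : ℝ :=
  tangleProb n fun t => (normalize t.1, normalize t.2.1) ∈ S

/-- The distribution on pairs of binary trees induced by two independent uniformly
random plane binary trees with `n` leaves. -/
noncomputable def nuP (n : ℕ) (S : Finset (PTree × PTree)) : ℝ :=
  (((planeTrees n) ×ˢ (planeTrees n)).filter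
      fun p => (normalize p.1, normalize p.2) ∈ S).card / ((planeTrees n).card ^ 2 : ℝ)

/-- The total variation distance between `nuT` and `nuP`. -/
noncomputable def tvDist (n : ℕ) : ℝ :=
  ((binTrees n ×ˢ binTrees n).powerset).sup' (Finset.powerset_nonempty _)
    fun S => |nuT n S - nuP n S|

/-- The number of occurrences of (trees isomorphic to) `B` as a fringe subtree of `T`. -/
def occ (B : PTree) : PTree → ℕ
  | leaf => if normalize leaf = normalize B then 1 else 0
  | node l r => (if normalize (node l r) = normalize B then 1 else 0) + occ B l + occ B r

/-- The number of generators of the automorphism group of `T`: the number of internal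
vertices whose two branches are isomorphic. -/
def gens : PTree → ℕ
  | leaf => 0
  | node l r => (if normalize l = normalize r then 1 else 0) + gens l + gens r

/-- `T` has a root branch isomorphic to `B`. -/
def hasBranch (B : PTree) : PTree → Prop
  | leaf => False
  | node l r => normalize l = normalize B ∨ normalize r = normalize B

/-- The cherries of a plane binary tree whose leaves are numbered from `k` on
(left to right), as pairs of leaf positions. -/
def cherryList : PTree → ℕ → List (ℕ × ℕ)
  | leaf, _ => []
  | node leaf leaf, k => [(k, k + 1)]
  | node l r, k => cherryList l k ++ cherryList r (k + l.size)

/-- The number of matched cherries: cherries of `T` whose two leaves are matched by `L`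
to the two leaves of a cherry of `S`. -/
def matchedCherries (T S : PTree) (L : List ℕ) : ℕ :=
  (cherryList T 0).countP fun p =>
    (cherryList S 0).any fun q =>
      (L.getD p.1 0 == q.1 && L.getD p.2 0 == q.2) ||
      (L.getD p.1 0 == q.2 && L.getD p.2 0 == q.1)

/-- The number of automorphisms of the tanglegram represented by the triple `(T, L, S)`:
pairs of automorphisms of the two trees compatible with the matching `L`. -/
def tangleAutCount (T S : PTree) (L : List ℕ) : ℕ :=
  ((isoFuns T T).map fun a =>
    (isoFuns S S).countP fun b =>
      (List.range T.size).all fun i => L.getD (a i) 0 == b (L.getD i 0)).sum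

/-- The number of automorphisms of `T` whose cycle type is `μ(s) = 2^s 1^(n-2s)`,
i.e. involutions of the leaves moving exactly `2 s` leaves. -/
def autMuCount (T : PTree) (s : ℕ) : ℕ :=
  (isoFuns T T).countP fun f =>
    ((List.range T.size).all fun i => f (f i) == i) &&
    ((List.range T.size).countP fun i => !(f i == i)) == 2 * s

end PTree

namespace PTree

theorem size_pos (T : PTree) : 0 < T.size := by
  induction T with
  | leaf => simp [size]
  | node l r hl hr => simp only [size]; omega

theorem mem_isoFuns_node {l r l' r' : PTree} {f : ℕ → ℕ} :
    f ∈ isoFuns (node l r) (node l' r') ↔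
      (∃ g ∈ isoFuns l l', ∃ h ∈ isoFuns r r',
        f = fun i => if i < l.size then g i else h (i - l.size) + l'.size) ∨
      (∃ g ∈ isoFuns l r', ∃ h ∈ isoFuns r l',
        f = fun i => if i < l.size then g i + l'.size else h (i - l.size)) := by
  simp [isoFuns, eq_comm]

theorem size_eq_of_mem_isoFuns {T T' : PTree} {f : ℕ → ℕ} (hf : f ∈ isoFuns T T') :
    T.size = T'.size := by
  induction T generalizing T' f with
  | leaf => cases T' with
    | leaf => rfl
    | node => simp [isoFuns] at hf
  | node l r ihl ihr => cases T' with
    | leaf => simp [isoFuns] at hf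
    | node l' r' =>
      simp only [size]
      rcases mem_isoFuns_node.1 hf with ⟨g, hg, h, hh, -⟩ | ⟨g, hg, h, hh, -⟩
      · rw [ihl hg, ihr hh]
      · rw [ihl hg, ihr hh, add_comm]

theorem isoFuns_eq_nil {T T' : PTree} (h : T.size ≠ T'.size) : isoFuns T T' = [] :=
  List.eq_nil_iff_forall_not_mem.2 fun _ hf => h (size_eq_of_mem_isoFuns hf)

theorem lt_size_of_mem_isoFuns {T T' : PTree} {f : ℕ → ℕ} (hf : f ∈ isoFuns T T') {i : ℕ}
    (hi : i < T.size) : f i < T'.size := by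
  induction T generalizing T' f i with
  | leaf => cases T' with
    | leaf => simp [isoFuns] at hf; simpa [hf] using hi
    | node => simp [isoFuns] at hf
  | node l r ihl ihr => cases T' with
    | leaf => simp [isoFuns] at hf
    | node l' r' =>
      simp only [size] at hi ⊢
      rcases mem_isoFuns_node.1 hf with ⟨g, hg, h, hh, rfl⟩ | ⟨g, hg, h, hh, rfl⟩ <;>
      · by_cases hl : i < l.size
        · have := ihl hg hl
          simp only [hl, if_true]; omega
        · have := ihr hh (i := i - l.size) (by omega)
          simp only [hl, if_false]; omega

theorem exists_id_mem_isoFuns (T : PTree) : ∃ f ∈ isoFuns T T, ∀ i < T.size, f i = i := by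
  induction T with
  | leaf => exact ⟨_, List.mem_singleton_self _, fun _ _ => rfl⟩
  | node l r ihl ihr =>
    obtain ⟨g, hg, hgi⟩ := ihl
    obtain ⟨h, hh, hhi⟩ := ihr
    refine ⟨_, mem_isoFuns_node.2 (Or.inl ⟨g, hg, h, hh, rfl⟩), fun i hi => ?_⟩
    simp only [size] at hi
    by_cases hl : i < l.size
    · simp [hl, hgi i hl]
    · have := hhi (i - l.size) (by omega)
      simp only [hl, if_false]; omega

theorem exists_inv_mem_isoFuns {T T' : PTree} {f : ℕ → ℕ} (hf : f ∈ isoFuns T T') :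
    ∃ g ∈ isoFuns T' T, ∀ i < T.size, g (f i) = i := by
  induction T generalizing T' f with
  | leaf => cases T' with
    | leaf =>
      simp only [isoFuns, List.mem_singleton] at hf
      exact ⟨_, List.mem_singleton_self _, fun _ _ => by rw [hf]⟩
    | node => simp [isoFuns] at hf
  | node l r ihl ihr => cases T' with
    | leaf => simp [isoFuns] at hf
    | node l' r' =>
      rcases mem_isoFuns_node.1 hf with ⟨g, hg, h, hh, rfl⟩ | ⟨g, hg, h, hh, rfl⟩
      · obtain ⟨g', hg', hgi⟩ := ihl hg
        obtain ⟨h', hh', hhi⟩ := ihr hh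
        refine ⟨_, mem_isoFuns_node.2 (Or.inl ⟨g', hg', h', hh', rfl⟩), fun i hi => ?_⟩
        simp only [size] at hi
        by_cases hl : i < l.size
        · simp [hl, lt_size_of_mem_isoFuns hg hl, hgi i hl]
        · have := hhi (i - l.size) (by omega)
          simp only [hl, if_false, Nat.add_sub_cancel, this]
          rw [if_neg (by omega)]; omega
      · obtain ⟨g', hg', hgi⟩ := ihl hg
        obtain ⟨h', hh', hhi⟩ := ihr hh
        refine ⟨_, mem_isoFuns_node.2 (Or.inr ⟨h', hh', g', hg', rfl⟩), fun i hi => ?_⟩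
        simp only [size] at hi
        by_cases hl : i < l.size
        · simp only [hl, if_true, Nat.add_sub_cancel, hgi i hl]
          rw [if_neg (by omega)]
        · have := hhi (i - l.size) (by omega)
          have h3 := lt_size_of_mem_isoFuns hh (i := i - l.size) (by omega)
          simp only [hl, if_false, this, h3, if_true]; omega

theorem exists_comp_mem_isoFuns {T T' T'' : PTree} {f g : ℕ → ℕ} (hf : f ∈ isoFuns T T')
    (hg : g ∈ isoFuns T' T'') : ∃ h ∈ isoFuns T T'', ∀ i < T.size, h i = g (f i) := by
  induction T generalizing T' T'' f g with
  | leaf => cases T' with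
    | leaf =>
      simp only [isoFuns, List.mem_singleton] at hf
      exact ⟨_, hg, fun _ _ => by rw [hf]⟩
    | node => simp [isoFuns] at hf
  | node l r ihl ihr =>
    cases T' with
    | leaf => simp [isoFuns] at hf
    | node l' r' =>
    cases T'' with
    | leaf => simp [isoFuns] at hg
    | node l'' r'' =>
      rcases mem_isoFuns_node.1 hf with ⟨a, ha, b, hb, rfl⟩ | ⟨a, ha, b, hb, rfl⟩ <;>
      rcases mem_isoFuns_node.1 hg with ⟨c, hc, d, hd, rfl⟩ | ⟨c, hc, d, hd, rfl⟩
      · obtain ⟨p, hp, hpi⟩ := ihl ha hc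
        obtain ⟨q, hq, hqi⟩ := ihr hb hd
        refine ⟨_, mem_isoFuns_node.2 (Or.inl ⟨p, hp, q, hq, rfl⟩), fun i hi => ?_⟩
        simp only [size] at hi
        by_cases hl : i < l.size
        · simp [hl, lt_size_of_mem_isoFuns ha hl, hpi i hl]
        · simp [hl, hqi (i - l.size) (by omega)]
      · obtain ⟨p, hp, hpi⟩ := ihl ha hc
        obtain ⟨q, hq, hqi⟩ := ihr hb hd
        refine ⟨_, mem_isoFuns_node.2 (Or.inr ⟨p, hp, q, hq, rfl⟩), fun i hi => ?_⟩
        simp only [size] at hi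
        by_cases hl : i < l.size
        · simp [hl, lt_size_of_mem_isoFuns ha hl, hpi i hl]
        · simp [hl, hqi (i - l.size) (by omega)]
      · obtain ⟨p, hp, hpi⟩ := ihl ha hd
        obtain ⟨q, hq, hqi⟩ := ihr hb hc
        refine ⟨_, mem_isoFuns_node.2 (Or.inr ⟨p, hp, q, hq, rfl⟩), fun i hi => ?_⟩
        simp only [size] at hi
        by_cases hl : i < l.size
        · simp [hl, hpi i hl]
        · have := lt_size_of_mem_isoFuns hb (i := i - l.size) (by omega)
          simp [hl, this, hqi (i - l.size) (by omega)]
      · obtain ⟨p, hp, hpi⟩ := ihl ha hd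
        obtain ⟨q, hq, hqi⟩ := ihr hb hc
        refine ⟨_, mem_isoFuns_node.2 (Or.inl ⟨p, hp, q, hq, rfl⟩), fun i hi => ?_⟩
        simp only [size] at hi
        by_cases hl : i < l.size
        · simp [hl, hpi i hl]
        · have := lt_size_of_mem_isoFuns hb (i := i - l.size) (by omega)
          simp [hl, this, hqi (i - l.size) (by omega)]

theorem pairwise_ne_isoFuns (T T' : PTree) :
    (isoFuns T T').Pairwise fun f g => ∃ i < T.size, f i ≠ g i := by
  induction T generalizing T' with
  | leaf => cases T' <;> simp [isoFuns]
  | node l r ihl ihr => cases T' with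
    | leaf => simp [isoFuns]
    | node l' r' =>
      have key : ∀ a b, (List.flatMap (fun g => (isoFuns r b).map fun h =>
          (g, h)) (isoFuns l a)).Pairwise fun p q =>
            (∃ i < l.size, p.1 i ≠ q.1 i) ∨ (∃ i < r.size, p.2 i ≠ q.2 i) := by
        intro a b
        rw [List.pairwise_flatMap]
        refine ⟨fun g _ => ?_, ?_⟩
        · exact List.Pairwise.map _ (fun _ _ h => Or.inr h) (ihr b)
        · refine (ihl a).imp fun {f g} h => ?_
          simp only [List.mem_map]
          rintro _ ⟨_, -, rfl⟩ _ ⟨_, -, rfl⟩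
          exact Or.inl h
      have conv : ∀ a b (F : (ℕ → ℕ) → (ℕ → ℕ) → ℕ → ℕ),
          ((isoFuns l a).flatMap fun g => (isoFuns r b).map fun h => F g h) =
          ((isoFuns l a).flatMap fun g => (isoFuns r b).map fun h => (g, h)).map
            (fun p => F p.1 p.2) := by
        intro a b F
        simp [List.map_flatMap, Function.comp_def]
      simp only [isoFuns, size]
      rw [List.pairwise_append]
      refine ⟨?_, ?_, ?_⟩
      · rw [conv l' r' (fun g h i => if i < l.size then g i else h (i - l.size) + l'.size)]
        refine List.Pairwise.map _ ?_ (key l' r')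
        rintro p q (⟨i, hi, hne⟩ | ⟨i, hi, hne⟩)
        · exact ⟨i, by omega, by simpa [hi] using hne⟩
        · exact ⟨l.size + i, by omega, by simpa using hne⟩
      · rw [conv r' l' (fun g h i => if i < l.size then g i + l'.size else h (i - l.size))]
        refine List.Pairwise.map _ ?_ (key r' l')
        rintro p q (⟨i, hi, hne⟩ | ⟨i, hi, hne⟩)
        · exact ⟨i, by omega, by simpa [hi] using hne⟩
        · exact ⟨l.size + i, by omega, by simpa using hne⟩
      · simp only [List.mem_flatMap, List.mem_map]
        rintro _ ⟨g, hg, h, hh, rfl⟩ _ ⟨g', hg', h', hh', rfl⟩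
        refine ⟨0, by have := l.size_pos; omega, ?_⟩
        have := lt_size_of_mem_isoFuns hg l.size_pos
        simp only [l.size_pos, if_true]; omega

theorem encode_injective : Function.Injective encode := by
  intro T
  induction T with
  | leaf => intro T' h; cases T' <;> simp_all [encode]
  | node l r ihl ihr =>
    intro T' h
    cases T' with
    | leaf => simp [encode] at h
    | node l' r' =>
      simp only [encode, Nat.add_right_cancel_iff, Nat.pair_eq_pair] at h
      rw [ihl h.1, ihr h.2]

theorem normalize_eq_of_mem_isoFuns {T T' : PTree} {f : ℕ → ℕ} (hf : f ∈ isoFuns T T') :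
    normalize T = normalize T' := by
  induction T generalizing T' f with
  | leaf => cases T' with
    | leaf => rfl
    | node => simp [isoFuns] at hf
  | node l r ihl ihr => cases T' with
    | leaf => simp [isoFuns] at hf
    | node l' r' =>
      rcases mem_isoFuns_node.1 hf with ⟨g, hg, h, hh, -⟩ | ⟨g, hg, h, hh, -⟩
      · simp only [normalize, ihl hg, ihr hh]
      · simp only [normalize, ihl hg, ihr hh]
        rcases lt_trichotomy (encode (normalize r')) (encode (normalize l')) with h | h | h
        · rw [if_pos h.le, if_neg h.not_ge]
        · rw [encode_injective h]
        · rw [if_neg h.not_ge, if_pos h.le]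

theorem planeTrees_add_two (n : ℕ) : planeTrees (n + 2) =
    (Finset.range (n + 1)).attach.biUnion fun k =>
        ((planeTrees (k.1 + 1)) ×ˢ (planeTrees (n + 1 - k.1))).image
          fun p => node p.1 p.2 := by
  rw [planeTrees]

theorem mem_planeTrees {T : PTree} {n : ℕ} : T ∈ planeTrees n ↔ T.size = n := by
  induction T generalizing n with
  | leaf =>
    match n with
    | 0 => simp [planeTrees, size]
    | 1 => simp [planeTrees, size]
    | n + 2 => simp [planeTrees_add_two, size]
  | node l r ihl ihr =>
    have := l.size_pos
    have := r.size_pos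
    match n with
    | 0 => simp only [planeTrees, size, Finset.notMem_empty, false_iff]; omega
    | 1 => simp only [planeTrees, size, Finset.mem_singleton, reduceCtorEq, false_iff]; omega
    | n + 2 =>
      simp only [planeTrees_add_two, size, Finset.mem_biUnion, Finset.mem_attach, true_and,
        Finset.mem_image, Finset.mem_product, Subtype.exists, Finset.mem_range,
        Prod.exists, node.injEq]
      constructor
      · rintro ⟨k, hk, _, _, ⟨h1, h2⟩, rfl, rfl⟩
        rw [ihl] at h1
        rw [ihr] at h2
        omega
      · intro h
        refine ⟨l.size - 1, by omega, l, r, ⟨ihl.2 (by omega), ihr.2 (by omega)⟩, rfl, rfl⟩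

theorem planeTrees_nonempty {n : ℕ} (hn : 1 ≤ n) : (planeTrees n).Nonempty := by
  induction n, hn using Nat.le_induction with
  | base => exact ⟨leaf, mem_planeTrees.2 rfl⟩
  | succ n _ ih =>
    obtain ⟨T, hT⟩ := ih
    exact ⟨node T leaf, mem_planeTrees.2 (by simp [size, mem_planeTrees.1 hT])⟩

theorem length_isoFuns_node (l r l' r' : PTree) :
    (isoFuns (node l r) (node l' r')).length =
      (isoFuns l l').length * (isoFuns r r').length +
      (isoFuns l r').length * (isoFuns r l').length := by
  simp [isoFuns, List.length_flatMap]

theorem sum_length_isoFuns (T : PTree) :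
    ∑ T' ∈ planeTrees T.size, (isoFuns T T').length = 2 ^ (T.size - 1) := by
  induction T with
  | leaf => simp [size, planeTrees, isoFuns]
  | node l r ihl ihr =>
    have hl := l.size_pos
    have hr := r.size_pos
    have h1 : ∑ T' ∈ planeTrees (node l r).size, (isoFuns (node l r) T').length =
        ∑ T' ∈ (planeTrees l.size ×ˢ planeTrees r.size ∪
          planeTrees r.size ×ˢ planeTrees l.size).image (fun p => node p.1 p.2),
          (isoFuns (node l r) T').length := by
      symm
      refine Finset.sum_subset ?_ ?_
      · intro T' h
        simp only [Finset.mem_image, Finset.mem_union, Finset.mem_product, mem_planeTrees] at h ⊢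
        obtain ⟨p, hp, rfl⟩ := h
        simp only [size]; omega
      · intro T' _ h
        cases T' with
        | leaf => simp [isoFuns]
        | node l' r' =>
          rw [length_isoFuns_node]
          simp only [Finset.mem_image, Finset.mem_union, Finset.mem_product, mem_planeTrees,
            Prod.exists, node.injEq, not_exists, not_and] at h
          have h := fun h' => h l' r' h' rfl rfl
          have e1 : (isoFuns l l').length * (isoFuns r r').length = 0 := by
            by_cases h2 : l.size = l'.size
            · rw [isoFuns_eq_nil (T := r) (T' := r')]
              · simp
              · intro h3; exact h (by omega)
            · simp [isoFuns_eq_nil h2]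
          have e2 : (isoFuns l r').length * (isoFuns r l').length = 0 := by
            by_cases h2 : l.size = r'.size
            · rw [isoFuns_eq_nil (T := r) (T' := l')]
              · simp
              · intro h3; exact h (by omega)
            · simp [isoFuns_eq_nil h2]
          omega
    have inj : Function.Injective (fun p : PTree × PTree => node p.1 p.2) := by
      rintro ⟨a, b⟩ ⟨c, d⟩ h; simpa using h
    rw [h1, Finset.sum_image inj.injOn]
    simp only [length_isoFuns_node, Finset.sum_add_distrib]
    have e1 : ∑ p ∈ planeTrees l.size ×ˢ planeTrees r.size ∪ planeTrees r.size ×ˢ planeTrees l.size,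
        (isoFuns l p.1).length * (isoFuns r p.2).length =
        ∑ p ∈ planeTrees l.size ×ˢ planeTrees r.size,
        (isoFuns l p.1).length * (isoFuns r p.2).length := by
      symm
      refine Finset.sum_subset Finset.subset_union_left fun p _ hp => ?_
      simp only [Finset.mem_product, mem_planeTrees, not_and_or] at hp
      rcases hp with hp | hp <;> simp [isoFuns_eq_nil (Ne.symm hp)]
    have e2 : ∑ p ∈ planeTrees l.size ×ˢ planeTrees r.size ∪ planeTrees r.size ×ˢ planeTrees l.size,
        (isoFuns l p.2).length * (isoFuns r p.1).length =
        ∑ p ∈ planeTrees r.size ×ˢ planeTrees l.size,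
        (isoFuns r p.1).length * (isoFuns l p.2).length := by
      symm
      simp only [mul_comm (isoFuns r _).length]
      refine Finset.sum_subset Finset.subset_union_right fun p _ hp => ?_
      simp only [Finset.mem_product, mem_planeTrees, not_and_or] at hp
      rcases hp with hp | hp <;> simp [isoFuns_eq_nil (Ne.symm hp)]
    rw [e1, e2, Finset.sum_product, Finset.sum_product]
    dsimp only
    rw [← Finset.sum_mul_sum, ← Finset.sum_mul_sum, ihl, ihr]
    simp only [size]
    rw [show l.size + r.size - 1 = (l.size - 1) + (r.size - 1) + 1 by omega, pow_succ, pow_add]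
    ring

theorem length_isoFuns_le (T T' : PTree) : (isoFuns T T').length ≤ 2 ^ (T.size - 1) := by
  by_cases h : T.size = T'.size
  · rw [← sum_length_isoFuns]
    exact Finset.single_le_sum (f := fun T' => (isoFuns T T').length) (fun _ _ => Nat.zero_le _)
      (mem_planeTrees.2 h.symm)
  · simp [isoFuns_eq_nil h]

/-- The number of `i < n` moved by `f`. -/
def moved (n : ℕ) (f : ℕ → ℕ) : ℕ := ∑ i ∈ Finset.range n, if f i = i then 0 else 1

/-- The generating function, evaluated at `z`, of the automorphisms of `T` by half the number of
leaves they move. -/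
noncomputable def autWeight (T : PTree) (z : ℝ) : ℝ :=
  ((isoFuns T T).map fun f => z ^ (moved T.size f / 2)).sum

theorem moved_direct (a b : ℕ) {g h : ℕ → ℕ} :
    moved (a + b) (fun i => if i < a then g i else h (i - a) + a) = moved a g + moved b h := by
  simp only [moved, Finset.sum_range_add]
  congr 1
  · refine Finset.sum_congr rfl fun i hi => ?_
    simp [Finset.mem_range.1 hi]
  · refine Finset.sum_congr rfl fun i _ => ?_
    have : h i + a = a + i ↔ h i = i := by omega
    simp [this]

theorem moved_swap {l r : PTree} {g h : ℕ → ℕ} (hg : g ∈ isoFuns l r) (hh : h ∈ isoFuns r l) :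
    moved (l.size + r.size) (fun i => if i < l.size then g i + l.size else h (i - l.size)) =
      2 * l.size := by
  rw [moved, Finset.sum_congr rfl (g := fun _ => 1)]
  · have := size_eq_of_mem_isoFuns hg
    simp; omega
  · intro i hi
    rw [Finset.mem_range] at hi
    by_cases hl : i < l.size
    · simp only [hl, if_true]; rw [if_neg (by omega)]
    · have := lt_size_of_mem_isoFuns hh (i := i - l.size) (by omega)
      simp only [hl, if_false]; rw [if_neg (by omega)]

theorem even_moved {T : PTree} {f : ℕ → ℕ} (hf : f ∈ isoFuns T T) : Even (moved T.size f) := by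
  induction T generalizing f with
  | leaf =>
    simp only [isoFuns, List.mem_singleton] at hf
    simp [moved, hf]
  | node l r ihl ihr =>
    simp only [size]
    rcases mem_isoFuns_node.1 hf with ⟨g, hg, h, hh, rfl⟩ | ⟨g, hg, h, hh, rfl⟩
    · rw [moved_direct]
      exact (ihl hg).add (ihr hh)
    · rw [moved_swap hg hh]
      exact even_two_mul _

theorem autWeight_node (l r : PTree) (z : ℝ) :
    autWeight (node l r) z = autWeight l z * autWeight r z +
      (isoFuns l r).length * (isoFuns r l).length * z ^ l.size := by
  simp only [autWeight, isoFuns, size, List.map_append, List.sum_append, List.map_flatMap,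
    List.map_map, Function.comp_def]
  congr 1
  · rw [List.flatMap_def, List.sum_flatten, List.map_map, ← List.sum_map_mul_right]
    refine congrArg _ (List.map_congr_left fun g hg => ?_)
    rw [← List.sum_map_mul_left]
    refine congrArg _ (List.map_congr_left fun h hh => ?_)
    rw [moved_direct, ← pow_add]
    have := even_moved hg
    have := even_moved hh
    congr 1
    grind
  · rw [List.flatMap_def, List.sum_flatten, List.map_map]
    have : ∀ g ∈ isoFuns l r, ((isoFuns r l).map fun h => z ^ (moved (l.size + r.size)
        (fun i => if i < l.size then g i + l.size else h (i - l.size)) / 2)).sum =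
        (isoFuns r l).length * z ^ l.size := by
      intro g hg
      rw [List.map_congr_left (g := fun _ => z ^ l.size)]
      · simp
      · intro h hh
        rw [moved_swap hg hh]
        simp
    simp only [Function.comp_def]
    rw [List.map_congr_left this]
    simp [mul_assoc]

theorem autWeight_nonneg (T : PTree) {z : ℝ} (hz : 0 ≤ z) : 0 ≤ autWeight T z :=
  List.sum_nonneg (by simp only [List.mem_map]; rintro _ ⟨f, -, rfl⟩; positivity)

theorem autWeight_le_exp (T : PTree) {z : ℝ} (hz : 0 ≤ z) :
    autWeight T z ≤ Real.exp (4 * (T.size - 1) * z) := by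
  induction T with
  | leaf => simp [autWeight, isoFuns, size, moved]
  | node l r ihl ihr =>
    rw [autWeight_node]
    have hl := l.size_pos
    have hr := r.size_pos
    have h1 : autWeight l z * autWeight r z ≤ Real.exp (4 * (l.size + r.size - 2) * z) := by
      refine (mul_le_mul ihl ihr (autWeight_nonneg r hz) (Real.exp_pos _).le).trans_eq ?_
      rw [← Real.exp_add]
      ring_nf
    have h2 : ((isoFuns l r).length * (isoFuns r l).length : ℝ) * z ^ l.size ≤
        4 * z * Real.exp (4 * (l.size + r.size - 2) * z) := by
      by_cases h : l.size = r.size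
      · obtain ⟨k, hk⟩ := Nat.exists_eq_add_of_lt hl
        have hk : l.size = k + 1 := by omega
        have b1 : ((isoFuns l r).length : ℝ) ≤ 2 ^ k := by
          have := length_isoFuns_le l r
          rw [hk] at this; exact_mod_cast this
        have b2 : ((isoFuns r l).length : ℝ) ≤ 2 ^ k := by
          have := length_isoFuns_le r l
          rw [← h, hk] at this; exact_mod_cast this
        have b3 : (4 * z) ^ k ≤ Real.exp (4 * (l.size + r.size - 2) * z) := by
          rw [← h, hk]
          push_cast
          have := Real.pow_div_factorial_le_exp (4 * (k + 1 + (k + 1) - 2) * z)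
            (by have : (k + 1 + (k + 1) - 2 : ℝ) = 2 * k := by ring
                rw [this]; positivity) k
          refine le_trans ?_ this
          rw [le_div_iff₀ (by positivity)]
          have e : (4 * (k + 1 + (k + 1) - 2) * z : ℝ) = (4 * z) * (2 * k) := by ring
          rw [e, mul_pow (4 * z)]
          gcongr
          have : (k.factorial : ℝ) ≤ k ^ k := by exact_mod_cast Nat.factorial_le_pow k
          refine this.trans ?_
          gcongr
          linarith [(Nat.cast_nonneg k : (0 : ℝ) ≤ k)]
        calc ((isoFuns l r).length * (isoFuns r l).length : ℝ) * z ^ l.size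
            ≤ (2 ^ k * 2 ^ k) * z ^ (k + 1) := by rw [hk]; gcongr
          _ = z * (4 * z) ^ k := by
            rw [mul_pow, show (4 : ℝ) = 2 * 2 by norm_num, mul_pow]; ring
          _ ≤ 4 * z * Real.exp (4 * (l.size + r.size - 2) * z) := by
            gcongr
            linarith
      · rw [isoFuns_eq_nil h]
        simp
        positivity
    have h3 : 1 + 4 * z ≤ Real.exp (4 * z) := by linarith [Real.add_one_le_exp (4 * z)]
    calc _ ≤ Real.exp (4 * (l.size + r.size - 2) * z) * (1 + 4 * z) := by linarith
      _ ≤ Real.exp (4 * (l.size + r.size - 2) * z) * Real.exp (4 * z) := by gcongr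
      _ = _ := by rw [← Real.exp_add]; simp only [size]; push_cast; ring_nf

theorem _root_.Multiset.prod_le_two_pow_sum (m : Multiset ℕ) : m.prod ≤ 2 ^ m.sum := by
  induction m using Multiset.induction with
  | empty => simp
  | cons a m ih =>
    rw [Multiset.prod_cons, Multiset.sum_cons, pow_add]
    exact Nat.mul_le_mul Nat.lt_two_pow_self.le ih

theorem card_intertwiners_le {n : ℕ} (σ τ : Equiv.Perm (Fin n)) :
    (Finset.univ.filter fun v : Equiv.Perm (Fin n) => v * σ = τ * v).card ≤
      if σ.support.card = τ.support.card then
        (n - σ.support.card).factorial * 2 ^ σ.support.card * (σ.support.card / 2).factorial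
      else 0 := by
  by_cases hv : ∃ v₀ : Equiv.Perm (Fin n), v₀ * σ = τ * v₀
  · obtain ⟨v₀, hv₀⟩ := hv
    have hτ : τ = v₀ * σ * v₀⁻¹ := by rw [hv₀]; group
    have hs : σ.support.card = τ.support.card := by
      rw [hτ, Equiv.Perm.card_support_conj]
    rw [if_pos hs]
    have h1 : (Finset.univ.filter fun v : Equiv.Perm (Fin n) => v * σ = τ * v).card ≤
        Nat.card (Subgroup.centralizer {σ}) := by
      rw [← Fintype.card_coe, ← Nat.card_eq_fintype_card]
      refine Nat.card_le_card_of_injective (fun v => ⟨v₀⁻¹ * v.1, ?_⟩) ?_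
      · rw [Subgroup.mem_centralizer_singleton_iff]
        obtain ⟨v, hv⟩ := v
        rw [Finset.mem_filter] at hv
        dsimp only
        rw [mul_assoc, hv.2, hτ]
        group
      · intro v w h
        exact Subtype.ext (mul_left_cancel (congrArg Subtype.val h))
    refine h1.trans ?_
    rw [Equiv.Perm.nat_card_centralizer, Equiv.Perm.sum_cycleType, Fintype.card_fin]
    have h2 := Multiset.prod_le_two_pow_sum σ.cycleType
    rw [Equiv.Perm.sum_cycleType] at h2
    have h3 : ∏ c ∈ σ.cycleType.toFinset, (σ.cycleType.count c).factorial ≤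
        (σ.support.card / 2).factorial := by
      refine (Nat.le_of_dvd (Nat.factorial_pos _)
        (Nat.prod_factorial_dvd_factorial_sum _ _)).trans ?_
      rw [Multiset.toFinset_sum_count_eq]
      refine Nat.factorial_le ?_
      rw [Nat.le_div_iff_mul_le two_pos, ← Equiv.Perm.sum_cycleType, ← smul_eq_mul]
      exact Multiset.card_nsmul_le_sum fun _ h => Equiv.Perm.two_le_of_mem_cycleType h
    gcongr
  · rw [Finset.filter_eq_empty_iff.2 fun v _ h => hv ⟨v, h⟩]
    simp

theorem _root_.Nat.pow_le_exp_mul_descFactorial {n m : ℕ} (h : m ≤ n) :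
    (n : ℝ) ^ m ≤ Real.exp m * n.descFactorial m := by
  induction n generalizing m with
  | zero => simp [Nat.le_zero.1 h]
  | succ n ih =>
    cases m with
    | zero => simp
    | succ m =>
      have hm : m ≤ n := by omega
      have key : ((n : ℝ) + 1) ^ m ≤ Real.exp 1 * n ^ m := by
        rcases Nat.eq_zero_or_pos n with rfl | hn
        · simp [Nat.le_zero.1 hm]
        · have hn' : (0 : ℝ) < n := by exact_mod_cast hn
          have e : ((n : ℝ) + 1) ^ m = (1 / n + 1) ^ m * n ^ m := by
            rw [← mul_pow]; congr 1; field_simp; ring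
          rw [e]
          gcongr
          calc ((1 : ℝ) / n + 1) ^ m ≤ Real.exp (1 / n) ^ m := by
                gcongr; exact Real.add_one_le_exp _
            _ = Real.exp (m / n) := by rw [← Real.exp_nat_mul]; ring_nf
            _ ≤ Real.exp 1 := by
                gcongr
                rw [div_le_one hn']
                exact_mod_cast hm
      rw [Nat.succ_descFactorial_succ]
      push_cast
      calc ((n : ℝ) + 1) ^ (m + 1) = (n + 1) * (n + 1) ^ m := by ring
        _ ≤ (n + 1) * (Real.exp 1 * (Real.exp m * n.descFactorial m)) := by
          gcongr
          exact key.trans (by gcongr; exact ih hm)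
        _ = Real.exp (m + 1) * ((n + 1) * n.descFactorial m) := by
          rw [Real.exp_add]; ring

theorem pow_mul_factorial_sub_le {n m : ℕ} (h : m ≤ n) :
    (n : ℝ) ^ m * (n - m).factorial ≤ Real.exp m * n.factorial := by
  rw [← Nat.factorial_mul_descFactorial h]
  have := Nat.pow_le_exp_mul_descFactorial h
  push_cast
  calc (n : ℝ) ^ m * (n - m).factorial ≤ (Real.exp m * n.descFactorial m) * (n - m).factorial := by
        gcongr
    _ = _ := by ring

/-- The permutation of `Fin n` that agrees with `f`, if there is one. -/
noncomputable def toPerm (n : ℕ) (f : ℕ → ℕ) : Equiv.Perm (Fin n) :=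
  if h : ∃ σ : Equiv.Perm (Fin n), ∀ i, (σ i : ℕ) = f i then h.choose else 1

theorem toPerm_apply {T T' : PTree} {f : ℕ → ℕ} (hf : f ∈ isoFuns T T') (i : Fin T.size) :
    (toPerm T.size f i : ℕ) = f i := by
  have h : ∃ σ : Equiv.Perm (Fin T.size), ∀ i, (σ i : ℕ) = f i := by
    have hlt : ∀ i : Fin T.size, f i < T.size := fun i =>
      (lt_size_of_mem_isoFuns hf i.2).trans_eq (size_eq_of_mem_isoFuns hf).symm
    obtain ⟨g, -, hg⟩ := exists_inv_mem_isoFuns hf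
    have hinj : Function.Injective fun i : Fin T.size => (⟨f i, hlt i⟩ : Fin T.size) := by
      intro i j hij
      simp only [Fin.mk.injEq] at hij
      exact Fin.ext (by rw [← hg i i.2, hij, hg j j.2])
    exact ⟨Equiv.ofBijective _ (Finite.injective_iff_bijective.1 hinj), fun _ => rfl⟩
  rw [toPerm, dif_pos h]
  exact h.choose_spec i

/-- The isomorphisms from `T` to `T'` as permutations of the leaf positions. -/
noncomputable def isoPerms (n : ℕ) (T T' : PTree) : Finset (Equiv.Perm (Fin n)) :=
  ((isoFuns T T').map (toPerm n)).toFinset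

theorem mem_isoPerms {n : ℕ} {T T' : PTree} (hT : T.size = n) {σ : Equiv.Perm (Fin n)} :
    σ ∈ isoPerms n T T' ↔ ∃ f ∈ isoFuns T T', ∀ i, (σ i : ℕ) = f i := by
  subst hT
  simp only [isoPerms, List.mem_toFinset, List.mem_map]
  constructor
  · rintro ⟨f, hf, rfl⟩
    exact ⟨f, hf, toPerm_apply hf⟩
  · rintro ⟨f, hf, h⟩
    exact ⟨f, hf, Equiv.ext fun i => Fin.ext (by rw [toPerm_apply hf, h])⟩

theorem nodup_map_toPerm (T T' : PTree) : ((isoFuns T T').map (toPerm T.size)).Nodup := by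
  refine List.pairwise_map.2 (List.pairwise_iff_forall_sublist.2 fun {f g} hs => ?_)
  obtain ⟨i, hi, hne⟩ := List.pairwise_iff_forall_sublist.1 (pairwise_ne_isoFuns T T') hs
  intro heq
  have hf : f ∈ isoFuns T T' := hs.subset (by simp)
  have hg : g ∈ isoFuns T T' := hs.subset (by simp)
  exact hne (by rw [← toPerm_apply hf ⟨i, hi⟩, heq, toPerm_apply hg])

theorem card_isoPerms {n : ℕ} {T T' : PTree} (hT : T.size = n) :
    (isoPerms n T T').card = (isoFuns T T').length := by
  subst hT
  rw [isoPerms, List.toFinset_card_of_nodup (nodup_map_toPerm T T'), List.length_map]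

theorem one_mem_isoPerms {n : ℕ} {T : PTree} (hT : T.size = n) : 1 ∈ isoPerms n T T := by
  obtain ⟨f, hf, h⟩ := exists_id_mem_isoFuns T
  exact (mem_isoPerms hT).2 ⟨f, hf, fun i => (h i (by omega)).symm⟩

theorem inv_mem_isoPerms {n : ℕ} {T T' : PTree} (hT : T.size = n) {σ : Equiv.Perm (Fin n)}
    (hσ : σ ∈ isoPerms n T T') : σ⁻¹ ∈ isoPerms n T' T := by
  obtain ⟨f, hf, h⟩ := (mem_isoPerms hT).1 hσ
  obtain ⟨g, hg, hgf⟩ := exists_inv_mem_isoFuns hf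
  refine (mem_isoPerms ((size_eq_of_mem_isoFuns hf).symm.trans hT)).2 ⟨g, hg, fun i => ?_⟩
  obtain ⟨j, rfl⟩ := σ.surjective i
  rw [h, hgf j (by omega), Equiv.Perm.inv_def, Equiv.symm_apply_apply]

theorem mul_mem_isoPerms {n : ℕ} {T T' T'' : PTree} (hT : T.size = n) {σ τ : Equiv.Perm (Fin n)}
    (hσ : σ ∈ isoPerms n T T') (hτ : τ ∈ isoPerms n T' T'') : τ * σ ∈ isoPerms n T T'' := by
  obtain ⟨f, hf, h⟩ := (mem_isoPerms hT).1 hσ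
  obtain ⟨g, hg, h'⟩ := (mem_isoPerms ((size_eq_of_mem_isoFuns hf).symm.trans hT)).1 hτ
  obtain ⟨k, hk, h''⟩ := exists_comp_mem_isoFuns hf hg
  refine (mem_isoPerms hT).2 ⟨k, hk, fun i => ?_⟩
  rw [h'' i (by omega), Equiv.Perm.mul_apply, h', h]

theorem card_support_toPerm {T : PTree} {f : ℕ → ℕ} (hf : f ∈ isoFuns T T) :
    (toPerm T.size f).support.card = moved T.size f := by
  rw [moved, Finset.sum_range, ← Finset.filter_univ_mem (toPerm T.size f).support,
    Finset.card_filter]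
  refine Finset.sum_congr rfl fun i _ => ?_
  simp only [Equiv.Perm.mem_support, ne_eq, Fin.ext_iff, toPerm_apply hf]
  split_ifs <;> simp_all

theorem even_card_support {n : ℕ} {T : PTree} (hT : T.size = n) {σ : Equiv.Perm (Fin n)}
    (hσ : σ ∈ isoPerms n T T) : Even σ.support.card := by
  subst hT
  simp only [isoPerms, List.mem_toFinset, List.mem_map] at hσ
  obtain ⟨f, hf, rfl⟩ := hσ
  rw [card_support_toPerm hf]
  exact even_moved hf

theorem sum_pow_support {n : ℕ} {T : PTree} (hT : T.size = n) (z : ℝ) :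
    ∑ σ ∈ isoPerms n T T, z ^ (σ.support.card / 2) = autWeight T z := by
  subst hT
  rw [isoPerms, List.sum_toFinset _ (nodup_map_toPerm T T), autWeight, List.map_map]
  refine congrArg _ (List.map_congr_left fun f hf => ?_)
  simp [card_support_toPerm hf]

/-- The number of automorphisms of `T` moving exactly `2 * k` leaves. -/
noncomputable def autCount (n : ℕ) (T : PTree) (k : ℕ) : ℕ :=
  ((isoPerms n T T).filter fun σ => σ.support.card = 2 * k).card

theorem autCount_le {n : ℕ} {T : PTree} (hT : T.size = n) (k : ℕ) :
    (autCount n T k : ℝ) * k ^ k ≤ Real.exp (4 * k) * n ^ k := by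
  have hn : (0 : ℝ) < n := by rw [← hT]; exact_mod_cast T.size_pos
  have h1 : (autCount n T k : ℝ) * (k / n) ^ k ≤ Real.exp (4 * k) := by
    have h2 : (autCount n T k : ℝ) * (k / n) ^ k ≤ autWeight T (k / n) := by
      rw [← sum_pow_support hT, autCount, ← nsmul_eq_mul, ← Finset.sum_const]
      rw [Finset.sum_congr rfl (g := fun σ => ((k : ℝ) / n) ^ (σ.support.card / 2))]
      · exact Finset.sum_le_sum_of_subset_of_nonneg (Finset.filter_subset _ _)
          fun _ _ _ => by positivity
      · intro σ hσ
        rw [(Finset.mem_filter.1 hσ).2]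
        simp
    refine h2.trans ((autWeight_le_exp T (by positivity)).trans ?_)
    rw [hT]
    rw [Real.exp_le_exp]
    have : (4 : ℝ) * (n - 1) * (k / n) ≤ 4 * n * (k / n) := by gcongr; linarith
    refine this.trans_eq ?_
    field_simp
  rw [div_pow, mul_div_assoc', div_le_iff₀ (by positivity)] at h1
  exact h1

theorem sum_card_intertwiners_le {n : ℕ} {T S : PTree} (hT : T.size = n) (hS : S.size = n) :
    ((∑ σ ∈ isoPerms n T T, ∑ τ ∈ isoPerms n S S,
      (Finset.univ.filter fun v : Equiv.Perm (Fin n) => v * σ = τ * v).card : ℕ) : ℝ) ≤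
      Real.exp (4 * Real.exp 10) * n.factorial := by
  have hn : (0 : ℝ) < n := by rw [← hT]; exact_mod_cast T.size_pos
  have h1 : ∑ σ ∈ isoPerms n T T, ∑ τ ∈ isoPerms n S S,
      (Finset.univ.filter fun v : Equiv.Perm (Fin n) => v * σ = τ * v).card ≤
      ∑ k ∈ Finset.range (n + 1), if 2 * k ≤ n then
        autCount n T k * autCount n S k * ((n - 2 * k).factorial * 2 ^ (2 * k) * k.factorial)
        else 0 := by
    have hmaps : ∀ σ ∈ isoPerms n T T, σ.support.card / 2 ∈ Finset.range (n + 1) := by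
      intro σ _
      have := σ.support.card_le_univ
      rw [Fintype.card_fin] at this
      rw [Finset.mem_range]; omega
    rw [← Finset.sum_fiberwise_of_maps_to hmaps]
    refine Finset.sum_le_sum fun k _ => ?_
    have hb : ∀ σ ∈ (isoPerms n T T).filter (fun σ => σ.support.card / 2 = k),
        σ.support.card = 2 * k ∧ 2 * k ≤ n := by
      intro σ hσ
      rw [Finset.mem_filter] at hσ
      have := (Nat.two_mul_div_two_of_even (even_card_support hT hσ.1))
      have h3 := σ.support.card_le_univ
      rw [Fintype.card_fin] at h3
      omega
    split_ifs with hk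
    · refine (Finset.sum_le_card_nsmul _ _
        (autCount n S k * ((n - 2 * k).factorial * 2 ^ (2 * k) * k.factorial)) ?_).trans ?_
      · intro σ hσ
        refine (Finset.sum_le_sum fun τ _ => card_intertwiners_le σ τ).trans ?_
        rw [(hb σ hσ).1, ← Finset.sum_filter, Finset.sum_const, smul_eq_mul, autCount]
        simp [eq_comm]
      · rw [smul_eq_mul, mul_assoc (autCount n T k)]
        refine Nat.mul_le_mul_right _ (Finset.card_le_card fun σ hσ => ?_)
        exact Finset.mem_filter.2 ⟨(Finset.mem_filter.1 hσ).1, (hb σ hσ).1⟩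
    · refine le_of_eq (Finset.sum_eq_zero fun σ hσ => absurd (hb σ hσ).2 hk)
  refine (Nat.cast_le.2 h1).trans ?_
  push_cast
  have h2 : ∀ k ∈ Finset.range (n + 1), (if 2 * k ≤ n then
        (autCount n T k * autCount n S k * ((n - 2 * k).factorial * 2 ^ (2 * k) * k.factorial) : ℝ)
        else 0) ≤ (4 * Real.exp 10) ^ k / k.factorial * n.factorial := by
    intro k _
    split_ifs with hk
    · have hkk : (0 : ℝ) < (k : ℝ) ^ k := by
        rcases Nat.eq_zero_or_pos k with rfl | h
        · simp
        · positivity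
      have a1 := autCount_le hT k
      have a2 := autCount_le hS k
      have a3 := pow_mul_factorial_sub_le hk
      have a4 : (k.factorial : ℝ) ≤ k ^ k := by exact_mod_cast Nat.factorial_le_pow k
      have hnk : (0 : ℝ) < (n : ℝ) ^ k := by positivity
      have e10 : Real.exp 10 ^ k = Real.exp (4 * k) * Real.exp (4 * k) * Real.exp (2 * k) := by
        rw [← Real.exp_nat_mul, ← Real.exp_add, ← Real.exp_add]; ring_nf
      have a5 : (autCount n T k : ℝ) ≤ Real.exp (4 * k) * n ^ k / k ^ k := by
        rwa [le_div_iff₀ hkk]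
      have a6 : (autCount n S k : ℝ) ≤ Real.exp (4 * k) * n ^ k / k ^ k := by
        rwa [le_div_iff₀ hkk]
      have a7 : ((n - 2 * k).factorial : ℝ) ≤ Real.exp (2 * k) * n.factorial / (n ^ k * n ^ k) := by
        rw [le_div_iff₀ (by positivity), ← pow_add, ← two_mul, mul_comm]
        exact_mod_cast a3
      have a8 : (k.factorial : ℝ) / (k ^ k * k ^ k) ≤ 1 / k.factorial := by
        rw [div_le_div_iff₀ (by positivity) (by positivity), one_mul]
        gcongr
      calc _ ≤ (Real.exp (4 * k) * n ^ k / k ^ k) * (Real.exp (4 * k) * n ^ k / k ^ k) *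
            ((Real.exp (2 * k) * n.factorial / (n ^ k * n ^ k)) * 2 ^ (2 * k) * k.factorial) := by
            gcongr
        _ = (4 * Real.exp 10) ^ k * n.factorial * (k.factorial / (k ^ k * k ^ k)) := by
            rw [mul_pow, e10, pow_mul]
            norm_num
            field_simp
        _ ≤ (4 * Real.exp 10) ^ k * n.factorial * (1 / k.factorial) := by gcongr
        _ = _ := by ring
    · positivity
  refine (Finset.sum_le_sum h2).trans ?_
  rw [← Finset.sum_mul]
  gcongr
  exact Real.sum_le_exp_of_nonneg (by positivity) _

section ClassCounting

variable {α : Type*} {X : Finset α} {r : α → α → Bool} {N : α → α → ℕ} {G : ℕ}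

theorem card_le_card_classes_mul (hr : ∀ x ∈ X, ∀ y ∈ X, r x y = true ↔ 0 < N x y)
    (refl : ∀ x ∈ X, r x x = true) (hG : ∀ x ∈ X, ∑ y ∈ X, N x y = G) :
    X.card ≤ G * (X.image fun x => X.filter fun y => r x y = true).card := by
  refine Finset.card_le_mul_card_image X G fun c hc => ?_
  obtain ⟨x₀, hx₀, rfl⟩ := Finset.mem_image.1 hc
  rw [← hG x₀ hx₀, Finset.card_eq_sum_ones]
  refine (Finset.sum_le_sum (g := fun y => N x₀ y) fun x hx => ?_).trans
    (Finset.sum_le_sum_of_subset (Finset.filter_subset _ _))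
  obtain ⟨hx, hxc⟩ := Finset.mem_filter.1 hx
  have : x ∈ X.filter fun y => r x₀ y = true := hxc ▸ Finset.mem_filter.2 ⟨hx, refl x hx⟩
  exact (hr x₀ hx₀ x hx).1 (Finset.mem_filter.1 this).2

theorem card_filter_classes_mul_le (hr : ∀ x ∈ X, ∀ y ∈ X, r x y = true ↔ 0 < N x y)
    (refl : ∀ x ∈ X, r x x = true)
    (symm : ∀ x ∈ X, ∀ y ∈ X, r x y = true → r y x = true)
    (trans : ∀ x ∈ X, ∀ y ∈ X, ∀ z ∈ X, r x y = true → r y z = true → r x z = true)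
    (hG : ∀ x ∈ X, ∑ y ∈ X, N x y = G) (hN : ∀ x ∈ X, ∀ y ∈ X, N x y ≤ N y y)
    {P : α → Prop} (hP : ∀ x ∈ X, ∀ y ∈ X, r x y = true → P x → P y) :
    ((X.image fun x => X.filter fun y => r x y = true).filter fun c => ∃ t ∈ c, P t).card * G ≤
      ∑ x ∈ X.filter P, N x x := by
  have hmaps : ∀ x ∈ X.filter P, (X.filter fun y => r x y = true) ∈
      (X.image fun x => X.filter fun y => r x y = true).filter fun c => ∃ t ∈ c, P t := by
    intro x hx
    obtain ⟨hx, hPx⟩ := Finset.mem_filter.1 hx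
    exact Finset.mem_filter.2 ⟨Finset.mem_image_of_mem _ hx, x,
      Finset.mem_filter.2 ⟨hx, refl x hx⟩, hPx⟩
  rw [← Finset.sum_fiberwise_of_maps_to hmaps, ← smul_eq_mul]
  refine Finset.card_nsmul_le_sum _ _ _ fun c hc => ?_
  obtain ⟨hc, t, ht, hPt⟩ := Finset.mem_filter.1 hc
  obtain ⟨x₀, hx₀, rfl⟩ := Finset.mem_image.1 hc
  obtain ⟨htX, ht⟩ := Finset.mem_filter.1 ht
  rw [← hG x₀ hx₀, ← Finset.sum_subset ((Finset.filter_subset _ _).trans (Finset.filter_subset P X))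
    (s₁ := (X.filter P).filter fun x =>
      (X.filter fun y => r x y = true) = X.filter fun y => r x₀ y = true)]
  · refine Finset.sum_le_sum fun x hx => hN x₀ hx₀ x ?_
    exact (Finset.mem_filter.1 (Finset.mem_filter.1 hx).1).1
  · intro y hy hny
    by_contra h0
    have hxy := (hr x₀ hx₀ y hy).2 (Nat.pos_of_ne_zero h0)
    refine hny (Finset.mem_filter.2 ⟨Finset.mem_filter.2 ⟨hy, ?_⟩, ?_⟩)
    · exact hP t htX y hy (trans t htX x₀ hx₀ y hy (symm x₀ hx₀ t htX ht) hxy) hPt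
    · ext z
      simp only [Finset.mem_filter, and_congr_right_iff]
      exact fun hz => ⟨trans x₀ hx₀ y hy z hz hxy,
        trans y hy x₀ hx₀ z hz (symm x₀ hx₀ y hy hxy)⟩

end ClassCounting

/-- The permutation of `Fin n` whose list of values is `L`, if there is one. -/
noncomputable def listPerm (n : ℕ) (L : List ℕ) : Equiv.Perm (Fin n) :=
  if h : ∃ v : Equiv.Perm (Fin n), List.ofFn (fun i => (v i : ℕ)) = L then h.choose else 1

theorem ofFn_val_injective (n : ℕ) :
    Function.Injective fun v : Equiv.Perm (Fin n) => List.ofFn fun i => (v i : ℕ) := by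
  intro v w h
  have := List.ofFn_injective h
  exact Equiv.ext fun i => Fin.ext (congrFun this i)

theorem listPerm_ofFn {n : ℕ} (v : Equiv.Perm (Fin n)) :
    listPerm n (List.ofFn fun i => (v i : ℕ)) = v := by
  have h : ∃ w : Equiv.Perm (Fin n), List.ofFn (fun i => (w i : ℕ)) =
    List.ofFn fun i => (v i : ℕ) := ⟨v, rfl⟩
  rw [listPerm, dif_pos h]
  exact ofFn_val_injective n h.choose_spec

theorem exists_ofFn_eq {n : ℕ} {L : List ℕ} (hL : L ∈ (List.range n).permutations.toFinset) :
    ∃ v : Equiv.Perm (Fin n), List.ofFn (fun i => (v i : ℕ)) = L := by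
  rw [List.mem_toFinset, List.mem_permutations] at hL
  have hlen : L.length = n := by simpa using hL.length_eq
  subst hlen
  have hnd : L.Nodup := hL.nodup_iff.2 List.nodup_range
  have hlt : ∀ i : Fin L.length, L[i] < L.length := fun i =>
    List.mem_range.1 (hL.mem_iff.1 (List.getElem_mem i.2))
  have hinj : Function.Injective fun i : Fin L.length => (⟨L[i], hlt i⟩ : Fin L.length) := by
    intro i j hij
    simp only [Fin.mk.injEq] at hij
    exact Fin.ext ((hnd.getElem_inj_iff).1 hij)
  exact ⟨Equiv.ofBijective _ (Finite.injective_iff_bijective.1 hinj), List.ofFn_getElem⟩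

theorem ofFn_listPerm {n : ℕ} {L : List ℕ} (hL : L ∈ (List.range n).permutations.toFinset) :
    List.ofFn (fun i => (listPerm n L i : ℕ)) = L := by
  rw [listPerm, dif_pos (exists_ofFn_eq hL)]
  exact (exists_ofFn_eq hL).choose_spec

theorem ofFn_mem_permutations {n : ℕ} (v : Equiv.Perm (Fin n)) :
    List.ofFn (fun i => (v i : ℕ)) ∈ (List.range n).permutations.toFinset := by
  rw [List.mem_toFinset, List.mem_permutations, List.perm_ext_iff_of_nodup _ List.nodup_range]
  · intro a
    simp only [List.mem_ofFn, List.mem_range]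
    constructor
    · rintro ⟨i, rfl⟩
      exact (v i).2
    · intro h
      exact ⟨v.symm ⟨a, h⟩, by simp⟩
  · exact List.nodup_ofFn.2 fun i j h => v.injective (Fin.ext h)

theorem sum_permutations {M : Type*} [AddCommMonoid M] {n : ℕ} (F : Equiv.Perm (Fin n) → M) :
    ∑ L ∈ (List.range n).permutations.toFinset, F (listPerm n L) = ∑ v, F v :=
  Finset.sum_bij' (fun L _ => listPerm n L) (fun v _ => List.ofFn fun i => (v i : ℕ))
    (fun _ _ => Finset.mem_univ _) (fun v _ => ofFn_mem_permutations v)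
    (fun _ hL => ofFn_listPerm hL) (fun v _ => listPerm_ofFn v) fun _ _ => rfl

theorem getD_eq_listPerm {n : ℕ} {L : List ℕ} (hL : L ∈ (List.range n).permutations.toFinset)
    (i : Fin n) : L.getD i 0 = listPerm n L i := by
  conv_lhs => rw [← ofFn_listPerm hL]
  simp [List.getD]

/-- The number of isomorphisms between two triples. -/
noncomputable def isoCount (n : ℕ) (t t' : PTree × PTree × List ℕ) : ℕ :=
  ((isoPerms n t.1 t'.1 ×ˢ isoPerms n t.2.1 t'.2.1).filter
    fun p => listPerm n t'.2.2 * p.1 = p.2 * listPerm n t.2.2).card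

theorem mem_Triples {n : ℕ} {t : PTree × PTree × List ℕ} : t ∈ Triples n ↔
    t.1.size = n ∧ t.2.1.size = n ∧ t.2.2 ∈ (List.range n).permutations.toFinset := by
  simp only [Triples, Finset.mem_product, mem_planeTrees]

theorem equivTriple_iff_exists {n : ℕ} {t t' : PTree × PTree × List ℕ} (ht : t ∈ Triples n)
    (ht' : t' ∈ Triples n) : equivTriple n t t' = true ↔
      ∃ σ ∈ isoPerms n t.1 t'.1, ∃ τ ∈ isoPerms n t.2.1 t'.2.1,
        listPerm n t'.2.2 * σ = τ * listPerm n t.2.2 := by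
  obtain ⟨h1, h2, h3⟩ := mem_Triples.1 ht
  obtain ⟨h1', h2', h3'⟩ := mem_Triples.1 ht'
  have key : ∀ {σ τ : Equiv.Perm (Fin n)} {f g : ℕ → ℕ}, (∀ i, (σ i : ℕ) = f i) →
      (∀ i, (τ i : ℕ) = g i) → ((∀ i < n, t'.2.2.getD (f i) 0 = g (t.2.2.getD i 0)) ↔
        listPerm n t'.2.2 * σ = τ * listPerm n t.2.2) := by
    intro σ τ f g hf hg
    rw [Equiv.ext_iff, Fin.forall_iff]
    refine forall₂_congr fun i hi => ?_
    have a := hf ⟨i, hi⟩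
    have b := getD_eq_listPerm h3 ⟨i, hi⟩
    dsimp only at a b
    rw [← a, b, ← hg, getD_eq_listPerm h3', Fin.ext_iff, Equiv.Perm.mul_apply,
      Equiv.Perm.mul_apply]
  simp only [equivTriple, List.any_eq_true, List.all_eq_true, beq_iff_eq, List.mem_range]
  constructor
  · rintro ⟨f, hf, g, hg, h⟩
    subst h1
    have a := toPerm_apply hf
    have b : ∀ i, (toPerm t.1.size g i : ℕ) = g i := by
      have := toPerm_apply hg
      rwa [h2] at this
    exact ⟨_, (mem_isoPerms rfl).2 ⟨f, hf, a⟩, _, (mem_isoPerms h2).2 ⟨g, hg, b⟩, (key a b).1 h⟩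
  · rintro ⟨σ, hσ, τ, hτ, h⟩
    obtain ⟨f, hf, a⟩ := (mem_isoPerms h1).1 hσ
    obtain ⟨g, hg, b⟩ := (mem_isoPerms h2).1 hτ
    exact ⟨f, hf, g, hg, (key a b).2 h⟩

theorem equivTriple_iff_isoCount_pos {n : ℕ} {t t' : PTree × PTree × List ℕ}
    (ht : t ∈ Triples n) (ht' : t' ∈ Triples n) :
    equivTriple n t t' = true ↔ 0 < isoCount n t t' := by
  rw [equivTriple_iff_exists ht ht', isoCount, Finset.card_pos, Finset.filter_nonempty_iff]
  simp only [Prod.exists, Finset.mem_product]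
  tauto

theorem equivTriple_refl {n : ℕ} {t : PTree × PTree × List ℕ} (ht : t ∈ Triples n) :
    equivTriple n t t = true := by
  obtain ⟨h1, h2, -⟩ := mem_Triples.1 ht
  exact (equivTriple_iff_exists ht ht).2
    ⟨1, one_mem_isoPerms h1, 1, one_mem_isoPerms h2, by simp⟩

theorem equivTriple_symm {n : ℕ} {t t' : PTree × PTree × List ℕ} (ht : t ∈ Triples n)
    (ht' : t' ∈ Triples n) (h : equivTriple n t t' = true) : equivTriple n t' t = true := by
  obtain ⟨h1, h2, -⟩ := mem_Triples.1 ht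
  obtain ⟨σ, hσ, τ, hτ, h⟩ := (equivTriple_iff_exists ht ht').1 h
  refine (equivTriple_iff_exists ht' ht).2
    ⟨σ⁻¹, inv_mem_isoPerms h1 hσ, τ⁻¹, inv_mem_isoPerms h2 hτ, ?_⟩
  rw [mul_inv_eq_iff_eq_mul, mul_assoc, h, inv_mul_cancel_left]

theorem equivTriple_trans {n : ℕ} {t t' t'' : PTree × PTree × List ℕ} (ht : t ∈ Triples n)
    (ht' : t' ∈ Triples n) (ht'' : t'' ∈ Triples n) (h : equivTriple n t t' = true)
    (h' : equivTriple n t' t'' = true) : equivTriple n t t'' = true := by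
  obtain ⟨h1, h2, -⟩ := mem_Triples.1 ht
  obtain ⟨σ, hσ, τ, hτ, h⟩ := (equivTriple_iff_exists ht ht').1 h
  obtain ⟨σ', hσ', τ', hτ', h'⟩ := (equivTriple_iff_exists ht' ht'').1 h'
  refine (equivTriple_iff_exists ht ht'').2
    ⟨_, mul_mem_isoPerms h1 hσ hσ', _, mul_mem_isoPerms h2 hτ hτ', ?_⟩
  rw [← mul_assoc, h', mul_assoc, h, mul_assoc]

theorem isoCount_le_self {n : ℕ} {t t' : PTree × PTree × List ℕ} (ht : t ∈ Triples n)
    (ht' : t' ∈ Triples n) : isoCount n t t' ≤ isoCount n t' t' := by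
  rcases Nat.eq_zero_or_pos (isoCount n t t') with h0 | h0
  · simp [h0]
  obtain ⟨h1, h2, -⟩ := mem_Triples.1 ht
  obtain ⟨h1', h2', -⟩ := mem_Triples.1 ht'
  obtain ⟨σ, hσ, τ, hτ, h⟩ := (equivTriple_iff_exists ht' ht).1
    (equivTriple_symm ht ht' ((equivTriple_iff_isoCount_pos ht ht').2 h0))
  refine Finset.card_le_card_of_injOn (fun p => (p.1 * σ, p.2 * τ)) ?_ ?_
  · rintro ⟨a, b⟩ hab
    simp only [Finset.coe_filter, Finset.mem_product, Set.mem_ofPred_eq] at hab ⊢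
    obtain ⟨⟨ha, hb⟩, e⟩ := hab
    exact ⟨⟨mul_mem_isoPerms h1' hσ ha, mul_mem_isoPerms h2' hτ hb⟩,
      by rw [← mul_assoc, e, mul_assoc, h, mul_assoc]⟩
  · rintro ⟨a, b⟩ - ⟨c, d⟩ - hh
    simpa using hh

theorem sum_card_isoPerms {n : ℕ} {T : PTree} (hT : T.size = n) :
    ∑ T' ∈ planeTrees n, (isoPerms n T T').card = 2 ^ (n - 1) := by
  simp only [card_isoPerms hT]
  rw [← hT, sum_length_isoFuns]

theorem sum_isoCount {n : ℕ} {t : PTree × PTree × List ℕ} (ht : t ∈ Triples n) :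
    ∑ t' ∈ Triples n, isoCount n t t' = 2 ^ (n - 1) * 2 ^ (n - 1) := by
  obtain ⟨h1, h2, -⟩ := mem_Triples.1 ht
  rw [Triples, Finset.sum_product]
  simp only [Finset.sum_product, isoCount]
  have key : ∀ T' S', ∑ L ∈ (List.range n).permutations.toFinset,
      ((isoPerms n t.1 T' ×ˢ isoPerms n t.2.1 S').filter
        fun p => listPerm n L * p.1 = p.2 * listPerm n t.2.2).card =
      (isoPerms n t.1 T').card * (isoPerms n t.2.1 S').card := by
    intro T' S'
    rw [sum_permutations fun v => ((isoPerms n t.1 T' ×ˢ isoPerms n t.2.1 S').filter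
        fun p => v * p.1 = p.2 * listPerm n t.2.2).card]
    simp only [Finset.card_filter]
    rw [Finset.sum_comm, ← Finset.card_product, Finset.card_eq_sum_ones]
    refine Finset.sum_congr rfl fun p _ => ?_
    simp only [← eq_mul_inv_iff_mul_eq]
    simp
  simp only [key]
  rw [← Finset.sum_mul_sum, sum_card_isoPerms h1, sum_card_isoPerms h2]

theorem card_Triples (n : ℕ) : (Triples n).card = (planeTrees n).card ^ 2 * n.factorial := by
  rw [Triples, Finset.card_product, Finset.card_product,
    List.toFinset_card_of_nodup (List.nodup_permutations _ List.nodup_range),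
    List.length_permutations, List.length_range]
  ring

theorem sum_isoCount_self_le (n : ℕ) (S : Finset (PTree × PTree)) :
    ((∑ t ∈ (Triples n).filter fun t => (normalize t.1, normalize t.2.1) ∈ S,
      isoCount n t t : ℕ) : ℝ) ≤
    Real.exp (4 * Real.exp 10) * n.factorial * ((planeTrees n ×ˢ planeTrees n).filter
      fun p => (normalize p.1, normalize p.2) ∈ S).card := by
  have h1 : ∑ t ∈ (Triples n).filter fun t => (normalize t.1, normalize t.2.1) ∈ S,
      isoCount n t t = ∑ p ∈ (planeTrees n ×ˢ planeTrees n).filter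
        fun p => (normalize p.1, normalize p.2) ∈ S,
        ∑ σ ∈ isoPerms n p.1 p.1, ∑ τ ∈ isoPerms n p.2 p.2,
        (Finset.univ.filter fun v : Equiv.Perm (Fin n) => v * σ = τ * v).card := by
    rw [Finset.sum_filter, Finset.sum_filter, Triples, Finset.sum_product, Finset.sum_product]
    refine Finset.sum_congr rfl fun T _ => ?_
    rw [Finset.sum_product]
    refine Finset.sum_congr rfl fun U _ => ?_
    dsimp only
    split_ifs with h
    · simp only [isoCount]
      rw [sum_permutations fun v => ((isoPerms n T T ×ˢ isoPerms n U U).filter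
        fun p => v * p.1 = p.2 * v).card]
      simp only [Finset.card_filter]
      rw [Finset.sum_comm, Finset.sum_product]
    · simp
  rw [h1]
  push_cast
  rw [mul_comm, ← nsmul_eq_mul]
  refine Finset.sum_le_card_nsmul _ _ _ fun p hp => ?_
  have hp := Finset.mem_product.1 (Finset.mem_filter.1 hp).1
  rw [mem_planeTrees, mem_planeTrees] at hp
  exact_mod_cast sum_card_intertwiners_le hp.1 hp.2

theorem normalize_eq_of_equivTriple {n : ℕ} {t t' : PTree × PTree × List ℕ}
    (h : equivTriple n t t' = true) :
    normalize t.1 = normalize t'.1 ∧ normalize t.2.1 = normalize t'.2.1 := by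
  simp only [equivTriple, List.any_eq_true] at h
  obtain ⟨f, hf, g, hg, -⟩ := h
  exact ⟨normalize_eq_of_mem_isoFuns hf, normalize_eq_of_mem_isoFuns hg⟩

theorem sq_card_planeTrees_mul_factorial_le {n : ℕ} :
    (planeTrees n).card ^ 2 * n.factorial ≤ 2 ^ (n - 1) * 2 ^ (n - 1) * numTanglegrams n := by
  have := card_le_card_classes_mul
    (fun x hx y hy => equivTriple_iff_isoCount_pos (n := n) hx hy)
    (fun x hx => equivTriple_refl hx) (fun x hx => sum_isoCount hx)
  rw [card_Triples] at this
  rw [numTanglegrams, tangleClasses]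
  convert this

theorem card_filter_tangleClasses_mul_le (n : ℕ) (S : Finset (PTree × PTree)) :
    (((tangleClasses n).filter fun c => ∃ t ∈ c,
      (normalize t.1, normalize t.2.1) ∈ S).card : ℝ) *
        ((2 ^ (n - 1) * 2 ^ (n - 1) : ℕ) : ℝ) ≤
      Real.exp (4 * Real.exp 10) * n.factorial *
        ((((planeTrees n) ×ˢ (planeTrees n)).filter
          fun p => (normalize p.1, normalize p.2) ∈ S).card : ℝ) := by
  have := card_filter_classes_mul_le
    (fun x hx y hy => equivTriple_iff_isoCount_pos (n := n) hx hy)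
    (fun x hx => equivTriple_refl hx)
    (fun x hx y hy => equivTriple_symm hx hy)
    (fun x hx y hy z hz => equivTriple_trans hx hy hz)
    (fun x hx => sum_isoCount hx) (fun x hx y hy => isoCount_le_self hx hy)
    (P := fun t => (normalize t.1, normalize t.2.1) ∈ S)
    (fun x _ y _ h hx => by
      rwa [← (normalize_eq_of_equivTriple h).1, ← (normalize_eq_of_equivTriple h).2])
  refine le_trans ?_ (sum_isoCount_self_le n S)
  rw [← Nat.cast_mul, Nat.cast_le, tangleClasses]
  convert this

theorem div_le_mul_div_of_mul_le {B D f G t K p : ℝ} (hB : 0 ≤ B) (hD : 0 < D) (hf : 0 < f)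
    (hG : 0 < G) (upper : B * G ≤ K * f * p) (lower : D * f ≤ G * t) :
    B / t ≤ K * (p / D) := by
  have ht : 0 < t := pos_of_mul_pos_right (lt_of_lt_of_le (by positivity) lower) hG.le
  rw [mul_div_assoc', div_le_div_iff₀ ht hD]
  refine le_of_mul_le_mul_right ?_ (mul_pos hf hG)
  have hKp : 0 ≤ K * f * p := le_trans (by positivity) upper
  calc B * D * (f * G) = (B * G) * (D * f) := by ring
    _ ≤ (K * f * p) * (G * t) := mul_le_mul upper lower (by positivity) hKp
    _ = K * p * t * (f * G) := by ring

theorem nuT_le_exp_mul_nuP {n : ℕ} (hn : 1 ≤ n) (S : Finset (PTree × PTree)) :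
    nuT n S ≤ Real.exp (4 * Real.exp 10) * nuP n S := by
  have hc : (0 : ℝ) < (planeTrees n).card := by exact_mod_cast (planeTrees_nonempty hn).card_pos
  have lower := (Nat.cast_le (α := ℝ)).2 (sq_card_planeTrees_mul_factorial_le (n := n))
  rw [Nat.cast_mul, Nat.cast_pow, Nat.cast_mul (2 ^ (n - 1) * 2 ^ (n - 1))] at lower
  exact div_le_mul_div_of_mul_le (G := (2 ^ (n - 1) * 2 ^ (n - 1) : ℕ))
    (Nat.cast_nonneg _) (pow_pos hc 2)
    (Nat.cast_pos.2 n.factorial_pos) (Nat.cast_pos.2 (by positivity))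
    (by convert card_filter_tangleClasses_mul_le n S) lower

end PTree

open PTree in
/-- Theorem 1 (second part, first inequality): there is a positive constant `M₁` with
`νT_n(S) ≤ M₁ · νP_n(S) + O(n⁻¹)` for every subset `S` of `B_n × B_n`,
the `O`-constant being absolute. -/
theorem nuT_le_mul_nuP_add :
    ∃ M₁ : ℝ, 0 < M₁ ∧ ∃ C : ℝ, ∀ n : ℕ, 1 ≤ n →
      ∀ S ⊆ binTrees n ×ˢ binTrees n, nuT n S ≤ M₁ * nuP n S + C / n := by
  refine ⟨Real.exp (4 * Real.exp 10), Real.exp_pos _, 0, fun n hn S _ => ?_⟩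
  rw [zero_div, add_zero]
  exact nuT_le_exp_mul_nuP hn S
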